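/- Let Σ be a symmetric positive definite real matrix indexed by V×V. Let a, c, z ∈ V be distinct and B ⊆ V \ {a, c, z}. Assume Σ_{az} = 0, Σ_{ca} = 0 and Σ_{cz} = 0 (i.e., a ⟂⟂ z and c ⟂⟂ {a, z}). Suppose there exists x ∈ V \ (B ∪ {a, c, z}) such that at least one of the following six conditions holds: (a) σ_{uw|{x}} = 0 for all u ∈ {a, z} and w ∈ B; (b) σ_{uw|{c,x}} = 0 for all u ∈ {a, z} and w ∈ B; (c) σ_{uw|{x}} = 0 for all u ∈ {c, z} and w ∈ B; (d) σ_{uw|{a,x}} = 0 for all u ∈ {c, z} and w ∈ B; (e) σ_{uw|{x}} = 0 for all u ∈ {a, c} and w ∈ B; (f) σ_{uw|{x,z}} = 0 for all u ∈ {a, c} and w ∈ B. Then ρ²_{ac|B} ≤ ρ²_{ac|B∪{z}}. -/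

import Mathlib

open Matrix

variable {V : Type*}

/-- Partial covariance `σ_{uv|Z} = Σ_{uv} − Σ_{uZ} (Σ_{ZZ})⁻¹ Σ_{Zv}`. -/
noncomputable def pcov [Fintype V] [DecidableEq V] (S : Matrix V V ℝ) (u v : V) (Z : Finset V) : ℝ :=
  S u v - ∑ i : {x // x ∈ Z}, ∑ j : {x // x ∈ Z},
    S u (i : V) * (Matrix.of (fun i j : {x // x ∈ Z} => S (i : V) (j : V)))⁻¹ i j * S (j : V) v

/-- Squared partial correlation `ρ²_{uv|Z}`. -/
noncomputable def rho2 [Fintype V] [DecidableEq V] (S : Matrix V V ℝ) (u v : V) (Z : Finset V) : ℝ :=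
  pcov S u v Z ^ 2 / (pcov S u u Z * pcov S v v Z)

/-- Restricting a positive definite matrix to `Z` preserves positive definiteness. -/
theorem posDef_restrict {S : Matrix V V ℝ} (hpd : S.PosDef) (Z : Finset V) :
    (Matrix.of (fun i j : {x // x ∈ Z} => S (i : V) (j : V))).PosDef :=
  hpd.submatrix Subtype.val_injective

/-- The regression coefficients of `u` on `Z` exist. -/
theorem exists_regression [DecidableEq V] {S : Matrix V V ℝ} (hpd : S.PosDef) (u : V) (Z : Finset V) :
    ∃ w : V → ℝ, ∀ j ∈ Z, ∑ i ∈ Z, w i * S i j = S u j := by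
  set M : Matrix {x // x ∈ Z} {x // x ∈ Z} ℝ := Matrix.of (fun i j => S (i : V) (j : V)) with hM
  have hdet : IsUnit M.det := (posDef_restrict hpd Z).det_pos.ne'.isUnit
  set p : {x // x ∈ Z} → ℝ := (fun i : {x // x ∈ Z} => S u i) ᵥ* M⁻¹ with hp
  have hpM : p ᵥ* M = fun i : {x // x ∈ Z} => S u i := by
    rw [hp, Matrix.vecMul_vecMul, Matrix.nonsing_inv_mul _ hdet, Matrix.vecMul_one]
  refine ⟨fun i => if h : i ∈ Z then p ⟨i, h⟩ else 0, fun j hj => ?_⟩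
  rw [← congrFun hpM ⟨j, hj⟩, ← Finset.sum_coe_sort Z]
  simp [Matrix.vecMul, dotProduct, hM]

section PartialCovariance

variable [Fintype V] [DecidableEq V] {S : Matrix V V ℝ}

/-- Any solution of the normal equations computes the partial covariance. -/
theorem pcov_eq_of_regression (hpd : S.PosDef) {u : V} {Z : Finset V} {w : V → ℝ}
    (hw : ∀ j ∈ Z, ∑ i ∈ Z, w i * S i j = S u j) (v : V) :
    pcov S u v Z = S u v - ∑ i ∈ Z, w i * S i v := by
  set M : Matrix {x // x ∈ Z} {x // x ∈ Z} ℝ := Matrix.of (fun i j => S (i : V) (j : V)) with hM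
  have hdet : IsUnit M.det := (posDef_restrict hpd Z).det_pos.ne'.isUnit
  have hwM : (fun i : {x // x ∈ Z} => w i) ᵥ* M = fun i : {x // x ∈ Z} => S u i := by
    funext j
    rw [← hw j j.2, ← Finset.sum_coe_sort Z]
    simp [Matrix.vecMul, dotProduct, hM]
  have hinv : (fun i : {x // x ∈ Z} => S u i) ᵥ* M⁻¹ = fun i : {x // x ∈ Z} => w i := by
    rw [← hwM, Matrix.vecMul_vecMul, Matrix.mul_nonsing_inv _ hdet, Matrix.vecMul_one]
  unfold pcov
  rw [← hM, Finset.sum_comm, ← Finset.sum_coe_sort Z]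
  congr 1
  refine Finset.sum_congr rfl fun j _ => ?_
  rw [← congrFun hinv j, ← Finset.sum_mul]
  simp [Matrix.vecMul, dotProduct]

theorem pcov_eq_zero_of_mem (hpd : S.PosDef) (u : V) {v : V} {Z : Finset V} (hv : v ∈ Z) :
    pcov S u v Z = 0 := by
  obtain ⟨w, hw⟩ := exists_regression hpd u Z
  rw [pcov_eq_of_regression hpd hw, hw v hv, sub_self]

theorem pcov_comm (hsym : S.IsSymm) (hpd : S.PosDef) (u v : V) (Z : Finset V) :
    pcov S u v Z = pcov S v u Z := by
  obtain ⟨w, hw⟩ := exists_regression hpd u Z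
  obtain ⟨w', hw'⟩ := exists_regression hpd v Z
  rw [pcov_eq_of_regression hpd hw, pcov_eq_of_regression hpd hw', hsym.apply v u]
  congr 1
  calc ∑ i ∈ Z, w i * S i v = ∑ i ∈ Z, ∑ j ∈ Z, w i * (w' j * S j i) :=
        Finset.sum_congr rfl fun i hi => by rw [← Finset.mul_sum, hw' i hi, hsym.apply v i]
    _ = ∑ j ∈ Z, ∑ i ∈ Z, w i * (w' j * S j i) := Finset.sum_comm
    _ = ∑ j ∈ Z, w' j * S j u := Finset.sum_congr rfl fun j hj => by
        rw [← hsym.apply j u, ← hw j hj, Finset.mul_sum]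
        exact Finset.sum_congr rfl fun i _ => by rw [hsym.apply i j]; ring

theorem rho2_comm (hsym : S.IsSymm) (hpd : S.PosDef) (u v : V) (Z : Finset V) :
    rho2 S u v Z = rho2 S v u Z := by
  rw [rho2, rho2, pcov_comm hsym hpd u v, mul_comm]

theorem pcov_self_pos (hpd : S.PosDef) {u : V} {Z : Finset V} (hu : u ∉ Z) :
    0 < pcov S u u Z := by
  obtain ⟨w, hw⟩ := exists_regression hpd u Z
  set y : V → ℝ := fun i => if i = u then 1 else if i ∈ Z then - w i else 0 with hy
  have hyu : y u = 1 := by simp [hy]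
  have hsum : ∀ f : V → ℝ, ∑ i, y i * f i = f u - ∑ i ∈ Z, w i * f i := by
    intro f
    have hsplit : ∀ i, y i * f i = (if i = u then f i else 0) - if i ∈ Z then w i * f i else 0 := by
      intro i
      by_cases h1 : i = u
      · subst h1; simp [hy, hu]
      · by_cases h2 : i ∈ Z <;> simp [hy, h1, h2]
    simp [hsplit, Finset.sum_sub_distrib]
  have hne : y ≠ 0 := fun h => by simp [h] at hyu
  have hpos := hpd.dotProduct_mulVec_pos hne
  have hq : star y ⬝ᵥ (S *ᵥ y) = ∑ j, y j * pcov S u j Z := by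
    rw [star_trivial, Matrix.dotProduct_mulVec, dotProduct_comm]
    refine Finset.sum_congr rfl fun j _ => ?_
    rw [pcov_eq_of_regression hpd hw, ← hsum fun i => S i j]
    rfl
  rw [hq, hsum, Finset.sum_eq_zero, sub_zero] at hpos
  · exact hpos
  · intro i hi
    rw [pcov_eq_zero_of_mem hpd u hi, mul_zero]

/-- The recursion for partial covariances. -/
theorem pcov_insert (hpd : S.PosDef) {z : V} {B : Finset V} (hz : z ∉ B) (u v : V) :
    pcov S u v (insert z B) =
      pcov S u v B - pcov S u z B / pcov S z z B * pcov S z v B := by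
  obtain ⟨w, hw⟩ := exists_regression hpd u B
  obtain ⟨w', hw'⟩ := exists_regression hpd z B
  have hpos := pcov_self_pos hpd hz
  set l := pcov S u z B / pcov S z z B with hl
  set y : V → ℝ := fun i => if i = z then l else w i - l * w' i with hy
  have hsum : ∀ j, ∑ i ∈ insert z B, y i * S i j =
      S u j - (pcov S u j B - l * pcov S z j B) := by
    intro j
    have hB : ∑ i ∈ B, y i * S i j = ∑ i ∈ B, w i * S i j - l * ∑ i ∈ B, w' i * S i j := by
      rw [Finset.mul_sum, ← Finset.sum_sub_distrib]
      refine Finset.sum_congr rfl fun i hi => ?_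
      have hiz : i ≠ z := fun h => hz (h ▸ hi)
      simp only [hy, hiz, if_false]
      ring
    rw [Finset.sum_insert hz, hB, pcov_eq_of_regression hpd hw, pcov_eq_of_regression hpd hw']
    simp only [hy, if_true]
    ring
  rw [pcov_eq_of_regression hpd (w := y), hsum]
  · ring
  · intro j hj
    rw [hsum]
    rcases Finset.mem_insert.mp hj with rfl | hj
    · rw [hl, div_mul_cancel₀ _ hpos.ne']
      ring
    · rw [pcov_eq_zero_of_mem hpd u hj, pcov_eq_zero_of_mem hpd z hj]
      ring

/-- A variable that is independent of `B` given `Z` and uncorrelated with `Z \ {x}` has a covariance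
row on `B` proportional to a vector depending on `x` and `Z` only. -/
theorem exists_row_of_pcov_eq_zero (S : Matrix V V ℝ) {x : V} {Z : Finset V} (hx : x ∈ Z) :
    ∃ r : V → ℝ, ∀ u w : V, (∀ i ∈ Z, i ≠ x → S u i = 0) → pcov S u w Z = 0 →
      S u w = S u x * r w := by
  refine ⟨fun w => ∑ j : {y // y ∈ Z},
    (Matrix.of (fun i j : {y // y ∈ Z} => S (i : V) (j : V)))⁻¹ ⟨x, hx⟩ j * S (j : V) w,
    fun u w hu h => ?_⟩
  rw [pcov, sub_eq_zero, Finset.sum_eq_single ⟨x, hx⟩] at h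
  · rw [h, Finset.mul_sum]
    exact Finset.sum_congr rfl fun j _ => mul_assoc _ _ _
  · intro i _ hi
    have hi' : S u i = 0 := hu i i.2 fun h => hi (Subtype.ext h)
    simp [hi']
  · simp

/-- Partial covariances when the covariance rows of `u` and `u'` on `B` are proportional to a common
vector. -/
theorem exists_pcov_of_row (hsym : S.IsSymm) (hpd : S.PosDef) {B : Finset V} {u u' : V}
    {α β : ℝ} {r : V → ℝ} (hu : ∀ w ∈ B, S u w = α * r w) (hu' : ∀ w ∈ B, S u' w = β * r w) :
    ∃ (q : ℝ) (f : V → ℝ), 0 ≤ q ∧ f u = α * q ∧ f u' = β * q ∧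
      (∀ v, pcov S u v B = S u v - α * f v) ∧ ∀ v, pcov S u' v B = S u' v - β * f v := by
  set M : Matrix {x // x ∈ B} {x // x ∈ B} ℝ := Matrix.of (fun i j => S (i : V) (j : V)) with hM
  set f : V → ℝ := fun v => ∑ i : {x // x ∈ B}, ∑ j : {x // x ∈ B}, r i * M⁻¹ i j * S j v with hf
  set q : ℝ := ∑ i : {x // x ∈ B}, ∑ j : {x // x ∈ B}, r i * M⁻¹ i j * r j with hq
  have hrow : ∀ {t : V} {γ : ℝ}, (∀ w ∈ B, S t w = γ * r w) → f t = γ * q ∧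
      ∀ v, pcov S t v B = S t v - γ * f v := by
    intro t γ ht
    constructor
    · simp only [hf, hq, Finset.mul_sum]
      refine Finset.sum_congr rfl fun i _ => Finset.sum_congr rfl fun j _ => ?_
      rw [← hsym.apply (j : V) t, ht j j.2]
      ring
    · intro v
      simp only [pcov, hf, ← hM, Finset.mul_sum]
      congr 1
      refine Finset.sum_congr rfl fun i _ => Finset.sum_congr rfl fun j _ => ?_
      rw [ht i i.2]
      ring
  refine ⟨q, f, ?_, (hrow hu).1, (hrow hu').1, (hrow hu).2, (hrow hu').2⟩
  have hnn := (posDef_restrict hpd B).inv.posSemidef.dotProduct_mulVec_nonneg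
    (fun i : {x // x ∈ B} => r i)
  simpa [hq, ← hM, dotProduct, Matrix.mulVec, Finset.mul_sum, mul_assoc] using hnn

/-- Monotonicity when the rows of `a` and `z` on `B` are proportional. -/
theorem rho2_le_insert_of_row_left (hsym : S.IsSymm) (hpd : S.PosDef) {a c z : V} (haz : a ≠ z)
    (hcz : c ≠ z) {B : Finset V} (haB : a ∉ B) (hcB : c ∉ B) (hzB : z ∉ B) (hSaz : S a z = 0)
    (hSac : S a c = 0) (hSzc : S z c = 0) {α β : ℝ} {r : V → ℝ}
    (ha : ∀ w ∈ B, S a w = α * r w) (hz : ∀ w ∈ B, S z w = β * r w) :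
    rho2 S a c B ≤ rho2 S a c (insert z B) := by
  obtain ⟨q, f, hq, hfa, hfz, hpa, hpz⟩ := exists_pcov_of_row hsym hpd ha hz
  have hAB := pcov_self_pos hpd haB
  have hCB := pcov_self_pos hpd hcB
  have hZB := pcov_self_pos hpd hzB
  have hA' := pcov_self_pos hpd (u := a) (Z := insert z B) (by simp [haz, haB])
  have hC' := pcov_self_pos hpd (u := c) (Z := insert z B) (by simp [hcz, hcB])
  have hA : 0 < S a a := hpd.diag_pos
  have hZ : 0 < S z z := hpd.diag_pos
  have hzz : pcov S z z B = S z z - β ^ 2 * q := by rw [hpz, hfz]; ring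
  have haz' : pcov S a z B = - (α * β * q) := by rw [hpa, hfz, hSaz]; ring
  have haa : pcov S a a B = S a a - α ^ 2 * q := by rw [hpa, hfa]; ring
  have hac : pcov S a c B = - (α * f c) := by rw [hpa, hSac]; ring
  have hzc : pcov S z c B = - (β * f c) := by rw [hpz, hSzc]; ring
  set D := pcov S z z B with hD
  set k := S z z / D with hk
  have hkpos : 0 < k := by positivity
  have hac' : pcov S a c (insert z B) = k * pcov S a c B := by
    rw [pcov_insert hpd hzB, haz', hac, hzc, ← hD, hk]
    field_simp
    rw [hzz]
    ring
  have haa' : pcov S a a (insert z B) ≤ k * pcov S a a B := by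
    rw [pcov_insert hpd hzB, pcov_comm hsym hpd z a, haz', haa, ← hD, hk, ← sub_nonneg]
    have h : S z z / D * (S a a - α ^ 2 * q) -
        (S a a - α ^ 2 * q - -(α * β * q) / D * -(α * β * q)) = S a a * (β ^ 2 * q) / D := by
      field_simp
      rw [hzz]
      ring
    rw [h]
    positivity
  have hcc' : pcov S c c (insert z B) ≤ k * pcov S c c B := by
    have h1 : pcov S c c (insert z B) ≤ pcov S c c B := by
      rw [pcov_insert hpd hzB, pcov_comm hsym hpd c z, div_mul_eq_mul_div, ← sq]
      exact sub_le_self _ (by positivity)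
    have h2 : 1 ≤ k := by
      rw [hk, one_le_div hZB, hzz]
      exact sub_le_self _ (by positivity)
    exact h1.trans (le_mul_of_one_le_left hCB.le h2)
  have hscale : rho2 S a c B =
      (k * pcov S a c B) ^ 2 / ((k * pcov S a a B) * (k * pcov S c c B)) := by
    rw [rho2]
    field_simp
  rw [hscale, rho2, hac']
  gcongr

/-- Monotonicity when the rows of `a` and `c` on `B` are proportional. -/
theorem rho2_le_insert_of_row (hsym : S.IsSymm) (hpd : S.PosDef) {a c z : V} (haz : a ≠ z)
    (hcz : c ≠ z) {B : Finset V} (haB : a ∉ B) (hcB : c ∉ B) (hzB : z ∉ B) (hSaz : S a z = 0)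
    (hSac : S a c = 0) (hScz : S c z = 0) {α γ : ℝ} {r : V → ℝ}
    (ha : ∀ w ∈ B, S a w = α * r w) (hc : ∀ w ∈ B, S c w = γ * r w) :
    rho2 S a c B ≤ rho2 S a c (insert z B) := by
  obtain ⟨q, f, hq, hfa, hfc, hpa, hpc⟩ := exists_pcov_of_row hsym hpd ha hc
  have hZB := pcov_self_pos hpd hzB
  have hA' := pcov_self_pos hpd (u := a) (Z := insert z B) (by simp [haz, haB])
  have hC' := pcov_self_pos hpd (u := c) (Z := insert z B) (by simp [hcz, hcB])
  have ht : 0 ≤ f z ^ 2 / pcov S z z B := by positivity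
  set q' := q + f z ^ 2 / pcov S z z B with hq'
  have haa : pcov S a a (insert z B) = S a a - α ^ 2 * q' := by
    rw [pcov_insert hpd hzB, pcov_comm hsym hpd z a, hpa, hpa, hfa, hSaz, hq']
    ring
  have hcc : pcov S c c (insert z B) = S c c - γ ^ 2 * q' := by
    rw [pcov_insert hpd hzB, pcov_comm hsym hpd z c, hpc, hpc, hfc, hScz, hq']
    ring
  have hac : pcov S a c (insert z B) = - (α * γ * q') := by
    rw [pcov_insert hpd hzB, pcov_comm hsym hpd z c, hpc, hpa, hpa, hfc, hSac, hSaz, hScz, hq']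
    ring
  have haa₀ : pcov S a a B = S a a - α ^ 2 * q := by rw [hpa, hfa]; ring
  have hcc₀ : pcov S c c B = S c c - γ ^ 2 * q := by rw [hpc, hfc]; ring
  have hac₀ : pcov S a c B = - (α * γ * q) := by rw [hpa, hfc, hSac]; ring
  have hle : q ≤ q' := by linarith
  have hAB : 0 ≤ S a a - α ^ 2 * q := haa₀ ▸ (pcov_self_pos hpd haB).le
  rw [haa] at hA'
  rw [hcc] at hC'
  rw [rho2, rho2, haa, hcc, hac, haa₀, hcc₀, hac₀, neg_sq, neg_sq, mul_pow, mul_pow _ q']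
  gcongr

end PartialCovariance

/-- Theorem 4 (i), first part: with `a ⟂⟂ z`, `c ⟂⟂ {a,z}` and one of the
six conditions (a)-(f), `ρ²_{ac|B} ≤ ρ²_{ac|B∪{z}}`. -/
theorem stmt_5 [Fintype V] [DecidableEq V] [Nonempty V]
    (S : Matrix V V ℝ) (hsym : S.IsSymm) (hpd : S.PosDef)
    (a c z : V) (hac : a ≠ c) (haz : a ≠ z) (hcz : c ≠ z)
    (B : Finset V) (haB : a ∉ B) (hcB : c ∉ B) (hzB : z ∉ B)
    (hSaz : S a z = 0) (hSca : S c a = 0) (hScz : S c z = 0)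
    (h : ∃ x : V, x ∉ B ∧ x ≠ a ∧ x ≠ c ∧ x ≠ z ∧
      ((∀ u ∈ ({a, z} : Finset V), ∀ w ∈ B, pcov S u w {x} = 0) ∨
       (∀ u ∈ ({a, z} : Finset V), ∀ w ∈ B, pcov S u w {c, x} = 0) ∨
       (∀ u ∈ ({c, z} : Finset V), ∀ w ∈ B, pcov S u w {x} = 0) ∨
       (∀ u ∈ ({c, z} : Finset V), ∀ w ∈ B, pcov S u w {a, x} = 0) ∨
       (∀ u ∈ ({a, c} : Finset V), ∀ w ∈ B, pcov S u w {x} = 0) ∨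
       (∀ u ∈ ({a, c} : Finset V), ∀ w ∈ B, pcov S u w {x, z} = 0))) :
    rho2 S a c B ≤ rho2 S a c (insert z B) := by
  obtain ⟨x, -, -, -, -, h⟩ := h
  have hSac : S a c = 0 := by rw [hsym.apply c a, hSca]
  have hSza : S z a = 0 := by rw [hsym.apply a z, hSaz]
  have hSzc : S z c = 0 := by rw [hsym.apply c z, hScz]
  have key : ∀ (Z : Finset V) (u v : V), x ∈ Z → (∀ i ∈ Z, i ≠ x → S u i = 0) →
      (∀ i ∈ Z, i ≠ x → S v i = 0) → (∀ t ∈ ({u, v} : Finset V), ∀ w ∈ B, pcov S t w Z = 0) →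
      ∃ r : V → ℝ, (∀ w ∈ B, S u w = S u x * r w) ∧ ∀ w ∈ B, S v w = S v x * r w := by
    intro Z u v hx hu hv hZ
    obtain ⟨r, hr⟩ := exists_row_of_pcov_eq_zero S hx
    exact ⟨r, fun w hw => hr u w hu (hZ u (by simp) w hw),
      fun w hw => hr v w hv (hZ v (by simp) w hw)⟩
  have left : ∀ r : V → ℝ, (∀ w ∈ B, S a w = S a x * r w) → (∀ w ∈ B, S z w = S z x * r w) →
      rho2 S a c B ≤ rho2 S a c (insert z B) := fun r ha hz =>
    rho2_le_insert_of_row_left hsym hpd haz hcz haB hcB hzB hSaz hSac hSzc ha hz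
  have right : ∀ r : V → ℝ, (∀ w ∈ B, S c w = S c x * r w) → (∀ w ∈ B, S z w = S z x * r w) →
      rho2 S a c B ≤ rho2 S a c (insert z B) := fun r hc hz => by
    rw [rho2_comm hsym hpd a c, rho2_comm hsym hpd a c]
    exact rho2_le_insert_of_row_left hsym hpd hcz haz hcB haB hzB hScz hSca hSza hc hz
  have mid : ∀ r : V → ℝ, (∀ w ∈ B, S a w = S a x * r w) → (∀ w ∈ B, S c w = S c x * r w) →
      rho2 S a c B ≤ rho2 S a c (insert z B) := fun r ha hc =>
    rho2_le_insert_of_row hsym hpd haz hcz haB hcB hzB hSaz hSac hScz ha hc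
  rcases h with h | h | h | h | h | h
  · obtain ⟨r, h1, h2⟩ := key _ _ _ (by simp) (by simp) (by simp) h
    exact left r h1 h2
  · obtain ⟨r, h1, h2⟩ := key _ _ _ (by simp) (by simp [hSac]) (by simp [hSzc]) h
    exact left r h1 h2
  · obtain ⟨r, h1, h2⟩ := key _ _ _ (by simp) (by simp) (by simp) h
    exact right r h1 h2
  · obtain ⟨r, h1, h2⟩ := key _ _ _ (by simp) (by simp [hSca]) (by simp [hSza]) h
    exact right r h1 h2
  · obtain ⟨r, h1, h2⟩ := key _ _ _ (by simp) (by simp) (by simp) h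
    exact mid r h1 h2
  · obtain ⟨r, h1, h2⟩ := key _ _ _ (by simp) (by simp [hSaz]) (by simp [hScz]) h
    exact mid r h1 h2
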